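/- arXiv:2101.10305 — 4 statements merged into one kernel-verified Lean document; each statement's English description precedes it below -/
import Mathlib

section
/- Let G be a finite two-player game with utility functions taking values in [0,1], minimax value v_i for player i, and adversarial policy-conditioned belief p_i^A(σ_i) ∈ argmin_{σ_{-i}} E[u_i(σ_i, σ_{-i})]. If a policy-conditioned belief p_i satisfies ‖p_i(σ_i) − p_i^A(σ_i)‖₁ ≤ ε for all σ_i, then p_i is ε-safe: every best response σ_i ∈ argmax_{σ'} E[u_i(σ', p_i(σ'))] satisfies E[u_i(σ_i, σ_{-i})] ≥ v_i − ε for all opponent strategies σ_{-i}. (Proposition 3 of the paper.) -/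
/-- A mixed strategy over a finite action set: nonnegative weights summing to 1. -/
def IsMixed {α : Type*} [Fintype α] (σ : α → ℝ) : Prop :=
  (∀ a, 0 ≤ σ a) ∧ ∑ a, σ a = 1

/-- Expected utility: the bilinear extension of `u` to mixed strategies. -/
def EU {A₁ A₂ : Type*} [Fintype A₁] [Fintype A₂]
    (u : A₁ → A₂ → ℝ) (σ : A₁ → ℝ) (τ : A₂ → ℝ) : ℝ :=
  ∑ a, ∑ b, σ a * τ b * u a b

/-- With utilities in `[0, 1]`, expected utility is 1-Lipschitz in the opponent's strategy
for the ℓ¹ distance. -/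
theorem EU_sub_le_sum_abs_sub {A₁ A₂ : Type*} [Fintype A₁] [Fintype A₂]
    {u : A₁ → A₂ → ℝ} (hu : ∀ a b, u a b ∈ Set.Icc (0 : ℝ) 1)
    {σ : A₁ → ℝ} (hσ : IsMixed σ) (τ τ' : A₂ → ℝ) :
    EU u σ τ - EU u σ τ' ≤ ∑ b, |τ b - τ' b| := by
  calc EU u σ τ - EU u σ τ'
      = ∑ a, ∑ b, σ a * ((τ b - τ' b) * u a b) := by
        simp only [EU, ← Finset.sum_sub_distrib]
        exact Finset.sum_congr rfl fun a _ => Finset.sum_congr rfl fun b _ => by ring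
    _ ≤ ∑ a, ∑ b, σ a * |τ b - τ' b| := by
        refine Finset.sum_le_sum fun a _ => Finset.sum_le_sum fun b _ =>
          mul_le_mul_of_nonneg_left ?_ (hσ.1 a)
        calc (τ b - τ' b) * u a b
            ≤ |τ b - τ' b| * u a b := mul_le_mul_of_nonneg_right (le_abs_self _) (hu a b).1
          _ ≤ |τ b - τ' b| := mul_le_of_le_one_right (abs_nonneg _) (hu a b).2
    _ = ∑ b, |τ b - τ' b| := by
        simp only [← Finset.mul_sum, ← Finset.sum_mul, hσ.2, one_mul]

/-- **Proposition 3.** In a finite two-player game with utilities in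
`[0,1]` and minimax value `v`, let `pA` be the adversarial policy-conditioned belief.
If a policy-conditioned belief `p` is `ε`-close to `pA` (pointwise ℓ¹ distance at most
`ε`), then `p` is `ε`-safe: every best response `σ` to `p` satisfies
`EU u σ τ ≥ v - ε` for all opponent mixed strategies `τ`. -/
theorem close_to_adversarial_belief_is_eps_safe
    {A₁ A₂ : Type*} [Fintype A₁] [Fintype A₂]
    (u : A₁ → A₂ → ℝ) (hu : ∀ a b, u a b ∈ Set.Icc (0 : ℝ) 1)
    (v : ℝ)
    (hv : IsGreatest {x : ℝ | ∃ σ, IsMixed σ ∧ ∀ τ, IsMixed τ → x ≤ EU u σ τ} v)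
    (pA : (A₁ → ℝ) → (A₂ → ℝ))
    (hpA : ∀ σ, IsMixed σ → IsMixed (pA σ) ∧ ∀ τ, IsMixed τ → EU u σ (pA σ) ≤ EU u σ τ)
    (p : (A₁ → ℝ) → (A₂ → ℝ))
    (hp : ∀ σ, IsMixed σ → IsMixed (p σ))
    (ε : ℝ)
    (hclose : ∀ σ, IsMixed σ → ∑ b, |p σ b - pA σ b| ≤ ε)
    (σ : A₁ → ℝ) (hσ : IsMixed σ)
    (hBR : ∀ σ', IsMixed σ' → EU u σ' (p σ') ≤ EU u σ (p σ)) :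
    ∀ τ : A₂ → ℝ, IsMixed τ → v - ε ≤ EU u σ τ := by
  intro τ hτ
  obtain ⟨ρ, hρ, hvρ⟩ := hv.1
  have h_safe := hvρ (p ρ) (hp ρ hρ)
  have h_best := hBR ρ hρ
  have h_near := (EU_sub_le_sum_abs_sub hu hσ (p σ) (pA σ)).trans (hclose σ hσ)
  have h_adv := (hpA σ hσ).2 τ hτ
  linarith
end

section
/- Let G be a finite two-player game whose utility function for player i has range at most K, i.e. max u_i − min u_i ≤ K, with minimax value v_i and adversarial policy-conditioned belief p_i^A(σ_i) ∈ argmin_{σ_{-i}} E[u_i(σ_i, σ_{-i})]. If a policy-conditioned belief p_i satisfies ‖p_i(σ_i) − p_i^A(σ_i)‖₁ ≤ ε for all σ_i, then p_i is Kε-safe: every best response σ_i ∈ argmax_{σ'} E[u_i(σ', p_i(σ'))] satisfies E[u_i(σ_i, σ_{-i})] ≥ v_i − Kε for all opponent strategies σ_{-i}. (The footnote generalization of Proposition 3 to payoffs of range K.) -/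
/-- If the payoffs lie within `K` of a constant, the expected utility is `K`-Lipschitz in the
opponent's mixed strategy for the `ℓ¹` distance. -/
theorem EU_sub_le {A₁ A₂ : Type*} [Fintype A₁] [Fintype A₂]
    {u : A₁ → A₂ → ℝ} {K c : ℝ} (hK : ∀ a b, |u a b - c| ≤ K)
    {σ : A₁ → ℝ} (hσ : IsMixed σ) {τ τ' : A₂ → ℝ} (hτ : IsMixed τ) (hτ' : IsMixed τ') :
    EU u σ τ - EU u σ τ' ≤ K * ∑ b, |τ b - τ' b| := by
  have hsum : ∑ b, (τ b - τ' b) = 0 := by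
    rw [Finset.sum_sub_distrib, hτ.2, hτ'.2, sub_self]
  calc EU u σ τ - EU u σ τ'
      = ∑ a, σ a * ∑ b, (τ b - τ' b) * u a b := by
        simp only [EU, ← Finset.sum_sub_distrib, Finset.mul_sum]
        exact Finset.sum_congr rfl fun a _ => Finset.sum_congr rfl fun b _ => by ring
    _ = ∑ a, σ a * ∑ b, (τ b - τ' b) * (u a b - c) := by
        simp only [mul_sub _ _ c, Finset.sum_sub_distrib (f := fun b => (τ b - τ' b) * u _ b),
          ← Finset.sum_mul, hsum, zero_mul, sub_zero]
    _ ≤ ∑ a, σ a * (K * ∑ b, |τ b - τ' b|) := by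
        refine Finset.sum_le_sum fun a _ => mul_le_mul_of_nonneg_left ?_ (hσ.1 a)
        rw [Finset.mul_sum]
        refine Finset.sum_le_sum fun b _ => (le_abs_self _).trans ?_
        rw [abs_mul, mul_comm]
        exact mul_le_mul_of_nonneg_right (hK a b) (abs_nonneg _)
    _ = K * ∑ b, |τ b - τ' b| := by rw [← Finset.sum_mul, hσ.2, one_mul]

/-- **footnote generalization of Proposition 3.** In a finite two-player
game whose utility for player `i` has range at most `K` (i.e. `u a b - u a' b' ≤ K` for
all action pairs), with minimax value `v` and adversarial policy-conditioned belief
`pA`, if a belief `p` is `ε`-close to `pA` (pointwise ℓ¹ distance at most `ε`), then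
`p` is `Kε`-safe: every best response `σ` to `p` satisfies `EU u σ τ ≥ v - Kε` for all
opponent mixed strategies `τ`. -/
theorem close_to_adversarial_belief_is_Keps_safe
    {A₁ A₂ : Type*} [Fintype A₁] [Fintype A₂]
    (u : A₁ → A₂ → ℝ) (K : ℝ)
    (hK : ∀ a b a' b', u a b - u a' b' ≤ K)
    (v : ℝ)
    (hv : IsGreatest {x : ℝ | ∃ σ, IsMixed σ ∧ ∀ τ, IsMixed τ → x ≤ EU u σ τ} v)
    (pA : (A₁ → ℝ) → (A₂ → ℝ))
    (hpA : ∀ σ, IsMixed σ → IsMixed (pA σ) ∧ ∀ τ, IsMixed τ → EU u σ (pA σ) ≤ EU u σ τ)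
    (p : (A₁ → ℝ) → (A₂ → ℝ))
    (hp : ∀ σ, IsMixed σ → IsMixed (p σ))
    (ε : ℝ)
    (hclose : ∀ σ, IsMixed σ → ∑ b, |p σ b - pA σ b| ≤ ε)
    (σ : A₁ → ℝ) (hσ : IsMixed σ)
    (hBR : ∀ σ', IsMixed σ' → EU u σ' (p σ') ≤ EU u σ (p σ)) :
    ∀ τ : A₂ → ℝ, IsMixed τ → v - K * ε ≤ EU u σ τ := by
  intro τ hτ
  obtain ⟨a, -⟩ : ∃ a, σ a ≠ 0 := by
    by_contra! h
    simpa [h] using hσ.2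
  obtain ⟨b, -⟩ : ∃ b, τ b ≠ 0 := by
    by_contra! h
    simpa [h] using hτ.2
  have hK0 : 0 ≤ K := by simpa using hK a b a b
  obtain ⟨σ', hσ', hv'⟩ := hv.1
  have hLip := EU_sub_le (c := u a b)
    (fun a' b' => abs_sub_le_iff.2 ⟨hK a' b' a b, hK a b a' b'⟩) hσ (hp σ hσ) (hpA σ hσ).1
  linarith [hv' _ (hp σ' hσ'), hBR σ' hσ', (hpA σ hσ).2 τ hτ,
    mul_le_mul_of_nonneg_left (hclose σ hσ) hK0]
end

section
/- Consider a two-player matrix social dilemma with payoffs R, S, T, P, discount factor γ ∈ (0,1], horizon n, parameters β, β⁺, β⁻ ∈ [0,1] (β⁻ ≤ β ≤ β⁺), threshold x ∈ (0,1], and mixing weight ε ∈ [0,1]. Under the ε-mixed belief p^{εC}, which sends α to (εβ, εβ⁺) when α ≥ x and to (εβ, εβ⁻) when α < x, cooperation at level α ∈ [x,1] with future level ᾱ ∈ [0,1] is at least as good as defection, i.e. V_i((α,ᾱ),(εβ,εβ⁺)) ≥ V_i((0,ᾱ),(εβ,εβ⁻)), if and only if α(P−S) − ε α β(R+P−S−T)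 ≤ Σ_{t=1}^{n−1} γ^t ε(β⁺−β⁻)[ᾱ(R+P−S−T) + T − P]. (Condition (1) of the paper.) -/
/-- Expected stage utility in a 2×2 social dilemma when player `i` cooperates with
probability `α` and the opponent cooperates with probability `β`. -/
def stageEU (R S T P α β : ℝ) : ℝ :=
  α * β * R + α * (1 - β) * S + (1 - α) * β * T + (1 - α) * (1 - β) * P

/-- Discounted `n`-round value of playing `α` now and `ᾱ` in all later rounds,
against an opponent playing `β` now and `βbar` in all later rounds. -/
def Vret (R S T P γ : ℝ) (n : ℕ) (α ᾱ β βbar : ℝ) : ℝ :=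
  stageEU R S T P α β + ∑ t ∈ Finset.Ico 1 n, γ ^ t * stageEU R S T P ᾱ βbar

theorem stageEU_sub_zero_left (R S T P α β : ℝ) :
    stageEU R S T P α β - stageEU R S T P 0 β = α * β * (R + P - S - T) - α * (P - S) := by
  unfold stageEU
  ring

theorem stageEU_sub_right (R S T P α β β' : ℝ) :
    stageEU R S T P α β - stageEU R S T P α β' =
      (β - β') * (α * (R + P - S - T) + T - P) := by
  unfold stageEU
  ring

theorem Vret_sub_Vret_zero (R S T P γ : ℝ) (n : ℕ) (α ᾱ β β₁ β₂ : ℝ) :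
    Vret R S T P γ n α ᾱ β β₁ - Vret R S T P γ n 0 ᾱ β β₂ =
      (α * β * (R + P - S - T) - α * (P - S)) +
        ∑ t ∈ Finset.Ico 1 n, γ ^ t * ((β₁ - β₂) * (ᾱ * (R + P - S - T) + T - P)) := by
  unfold Vret
  rw [add_sub_add_comm, ← Finset.sum_sub_distrib, stageEU_sub_zero_left]
  simp only [← mul_sub, stageEU_sub_right]

/-- **Condition (1) of the paper.** In a two-player matrix social
dilemma, under the `ε`-mixed belief `p^{εC}` (which sends `α` to `(εβ, εβ⁺)` when
`α ≥ x` and to `(εβ, εβ⁻)` when `α < x`), cooperation at level `α ∈ [x,1]` with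
future level `ᾱ ∈ [0,1]` is at least as good as defection iff
`α(P−S) − εαβ(R+P−S−T) ≤ Σ_{t=1}^{n−1} γ^t ε(β⁺−β⁻)[ᾱ(R+P−S−T)+T−P]`. -/
theorem cooperation_best_response_iff_mixed_belief
    (R S T P γ : ℝ) (n : ℕ)
    (hRP : R > P) (hRS : R > S) (hRTS : 2 * R > T + S) (hdil : T > R ∨ P > S)
    (hγ : γ ∈ Set.Ioc (0 : ℝ) 1)
    (β βplus βminus x ε α ᾱ : ℝ)
    (hβ : β ∈ Set.Icc (0 : ℝ) 1)
    (hβplus : βplus ∈ Set.Icc (0 : ℝ) 1)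
    (hβminus : βminus ∈ Set.Icc (0 : ℝ) 1)
    (hord : βminus ≤ β ∧ β ≤ βplus)
    (hx : x ∈ Set.Ioc (0 : ℝ) 1)
    (hε : ε ∈ Set.Icc (0 : ℝ) 1)
    (hα : α ∈ Set.Icc x 1)
    (hᾱ : ᾱ ∈ Set.Icc (0 : ℝ) 1) :
    Vret R S T P γ n α ᾱ (ε * β) (ε * βplus) ≥ Vret R S T P γ n 0 ᾱ (ε * β) (ε * βminus) ↔
      α * (P - S) - ε * α * β * (R + P - S - T) ≤
        ∑ t ∈ Finset.Ico 1 n,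
          γ ^ t * (ε * (βplus - βminus) * (ᾱ * (R + P - S - T) + T - P)) := by
  have h := Vret_sub_Vret_zero R S T P γ n α ᾱ (ε * β) (ε * βplus) (ε * βminus)
  rw [← mul_sub] at h
  constructor <;> intro _ <;> linarith
end

section
/- (Safety of the ARCTIC risk-capital update.) Let v ∈ ℝ, let T ≥ 0 be an integer, and let (r_t)_{t=0}^{T−1} be real numbers (the per-round expected rewards). Define the risk capital ε_0 ≥ 0 and ε_{t+1} = min(ε_t + r_t − v, 1) for 0 ≤ t < T. If at every round the policy risks at most its current risk capital, i.e. r_t ≥ v − ε_t for all t, then ε_t ≥ 0 for all t and the cumulative expected reward satisfies Σ_{t=0}^{T−1} r_t ≥ T·v − ε_0. In particular, if ε_0 = 0 the policy is safe: Σ_{t=0}^{T−1} r_t ≥ T·v. -/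
/-- **safety of the ARCTIC risk-capital update.** Let `v` be the
minimax value of the stage game, `T ≥ 0` an integer, and `(r_t)_{t=0}^{T−1}` per-round
expected rewards. The risk capital starts at `ε_0 ≥ 0` and is updated by
`ε_{t+1} = min (ε_t + r_t − v) 1`. If at every round the policy risks at most its
current risk capital (`r_t ≥ v − ε_t`), then the risk capital stays nonnegative and
`Σ_{t=0}^{T−1} r_t ≥ T·v − ε_0`; in particular with `ε_0 = 0` the policy is safe. -/
theorem arctic_update_is_safe
    (v : ℝ) (T : ℕ) (r : ℕ → ℝ) (εc : ℕ → ℝ)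
    (hε0 : 0 ≤ εc 0)
    (hupd : ∀ t, t < T → εc (t + 1) = min (εc t + r t - v) 1)
    (hrisk : ∀ t, t < T → v - εc t ≤ r t) :
    (∀ t, t ≤ T → 0 ≤ εc t) ∧
      (T : ℝ) * v - εc 0 ≤ ∑ t ∈ Finset.range T, r t := by
  have nonneg : ∀ t, t ≤ T → 0 ≤ εc t := by
    intro t ht
    cases t with
    | zero => exact hε0
    | succ t =>
      rw [hupd t ht]
      exact le_min (by linarith [hrisk t ht]) zero_le_one
  have capital_le : ∀ n, n ≤ T →
      (n : ℝ) * v - εc 0 + εc n ≤ ∑ t ∈ Finset.range n, r t := by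
    intro n
    induction n with
    | zero => simp
    | succ n ih =>
      intro hn
      have hstep : εc (n + 1) ≤ εc n + r n - v := hupd n hn ▸ min_le_left _ _
      rw [Finset.sum_range_succ]
      push_cast
      linarith [ih (Nat.le_of_succ_le hn)]
  exact ⟨nonneg, by linarith [capital_le T le_rfl, nonneg T le_rfl]⟩
end
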